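/- arXiv:1903.02754 — 3 statements merged into one kernel-verified Lean document; each statement's English description precedes it below -/
import Mathlib

section
/- Let ω > 0 and let w : [0,∞) → ℝ be measurable and integrable. Let ψ : [0,∞) → ℂ be twice continuously differentiable with −ψ''(x) − ω²ψ(x) + w(x)ψ(x) = 0 for all x ≥ 0. Then there exists a unique pair (A,B) ∈ ℂ² such that ψ(x) − A·e^{iωx} − B·e^{−iωx} → 0 as x → +∞. -/
open MeasureTheory Filter

/-- The interval integrals of an integrable function over intervals far from the origin are
arbitrarily small. -/
lemma exists_intervalIntegral_le_of_integrableOn_Ioi {v : ℝ → ℝ}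
    (hv : IntegrableOn v (Set.Ioi 0)) {ε : ℝ} (hε : 0 < ε) :
    ∃ X, 0 < X ∧ ∀ x, X ≤ x → ∫ t in X..x, v t ≤ ε := by
  have hT := intervalIntegral_tendsto_integral_Ioi 0 hv tendsto_id
  have hev := hT.eventually (Metric.ball_mem_nhds _ (half_pos hε))
  obtain ⟨X, hX⟩ := (hev.and (eventually_gt_atTop 0)).exists_forall_of_atTop
  refine ⟨X, (hX X le_rfl).2, fun x hx => ?_⟩
  have hint : ∀ y, 0 < y → IntervalIntegrable v volume 0 y := fun y hy =>
    (intervalIntegrable_iff_integrableOn_Ioc_of_le hy.le).2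
      (hv.mono_set Set.Ioc_subset_Ioi_self)
  have h1 := (hX X le_rfl).1
  have h2 := (hX x hx).1
  rw [Real.dist_eq, abs_lt] at h1 h2
  simp only [id] at h1 h2
  rw [← intervalIntegral.integral_interval_sub_left (hint x (hX x hx).2)
    (hint X (hX X le_rfl).2)]
  linarith [h1.1, h2.2]

/-- A Grönwall-type bound for an integral inequality whose kernel has total mass at most `1/2`. -/
lemma norm_le_two_mul_of_le_add_intervalIntegral {E : Type*} [NormedAddCommGroup E]
    {u : ℝ → E} {v : ℝ → ℝ} {X C : ℝ}
    (hu : ContinuousOn u (Set.Ici X)) (hv0 : ∀ t, 0 ≤ v t)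
    (hv : IntegrableOn v (Set.Ioi X)) (hv1 : ∀ x, X ≤ x → ∫ t in X..x, v t ≤ 1 / 2)
    (h : ∀ x, X ≤ x → ‖u x‖ ≤ C + ∫ t in X..x, v t * ‖u t‖) {x : ℝ} (hx : X ≤ x) :
    ‖u x‖ ≤ 2 * C := by
  obtain ⟨y, hy, hmax⟩ := isCompact_Icc.exists_isMaxOn (Set.nonempty_Icc.2 hx)
    (hu.norm.mono Set.Icc_subset_Ici_self)
  have hle : ‖∫ t in X..y, v t * ‖u t‖‖ ≤ ∫ t in X..y, v t * ‖u y‖ := by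
    refine intervalIntegral.norm_integral_le_of_norm_le hy.1 (ae_of_all _ fun t ht => ?_) ?_
    · rw [Real.norm_of_nonneg (mul_nonneg (hv0 t) (norm_nonneg _))]
      exact mul_le_mul_of_nonneg_left (hmax ⟨ht.1.le, ht.2.trans hy.2⟩) (hv0 t)
    · exact ((intervalIntegrable_iff_integrableOn_Ioc_of_le hy.1).2
        (hv.mono_set Set.Ioc_subset_Ioi_self)).mul_const _
  rw [intervalIntegral.integral_mul_const] at hle
  have h1 := mul_le_mul_of_nonneg_right (hv1 y hy.1) (norm_nonneg (u y))
  have h2 := h y hy.1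
  have h3 : ‖u x‖ ≤ ‖u y‖ := hmax ⟨hx, le_rfl⟩
  have h4 := (Real.le_norm_self _).trans hle
  linarith

/-- A combination of two opposite plane waves that tends to zero has vanishing first
coefficient. -/
lemma eq_zero_of_tendsto_planeWaves {ω : ℝ} (hω : ω ≠ 0) {C D : ℂ}
    (h : Tendsto (fun x : ℝ => C * Complex.exp (Complex.I * ω * x)
      + D * Complex.exp (-(Complex.I * ω * x))) atTop (nhds 0)) : C = 0 := by
  have hs := h.comp (tendsto_atTop_add_const_right atTop (Real.pi / 2 / ω) tendsto_id)
  have hsum := (h.const_mul Complex.I).add hs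
  have hω' : (ω : ℂ) ≠ 0 := Complex.ofReal_ne_zero.2 hω
  have key : ∀ x : ℝ, ‖Complex.I * (C * Complex.exp (Complex.I * ω * x)
      + D * Complex.exp (-(Complex.I * ω * x)))
      + (C * Complex.exp (Complex.I * ω * ((x + Real.pi / 2 / ω : ℝ) : ℂ))
      + D * Complex.exp (-(Complex.I * ω * ((x + Real.pi / 2 / ω : ℝ) : ℂ))))‖ = 2 * ‖C‖ := by
    intro x
    have e1 : Complex.I * ω * ((x + Real.pi / 2 / ω : ℝ) : ℂ)
        = Complex.I * ω * x + Real.pi / 2 * Complex.I := by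
      push_cast
      field_simp
    have e2 : Complex.exp (-(Real.pi / 2 * Complex.I)) = -Complex.I := by
      rw [Complex.exp_neg, Complex.exp_pi_div_two_mul_I, Complex.inv_I]
    rw [e1, neg_add, Complex.exp_add, Complex.exp_add, e2, Complex.exp_pi_div_two_mul_I]
    have e3 : Complex.I * (C * Complex.exp (Complex.I * ω * x)
        + D * Complex.exp (-(Complex.I * ω * x)))
        + (C * (Complex.exp (Complex.I * ω * x) * Complex.I)
        + D * (Complex.exp (-(Complex.I * ω * x)) * -Complex.I))
        = 2 * Complex.I * C * Complex.exp (((ω * x : ℝ) : ℂ) * Complex.I) := by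
      push_cast
      ring_nf
    rw [e3]
    simp only [norm_mul, Complex.norm_exp_ofReal_mul_I]
    simp
  have hn := hsum.norm
  simp only [Function.comp_def, id, key, mul_zero, add_zero, norm_zero] at hn
  simpa using tendsto_nhds_unique tendsto_const_nhds hn

/-- The derivative of the amplitude `(φ + cψ) e^{-cx} / (2c)` obtained by variation of constants. -/
lemma hasDerivAt_amplitude {ψ φ : ℝ → ℂ} {x : ℝ} {g c : ℂ}
    (hψ : HasDerivAt ψ (φ x) x) (hφ : HasDerivAt φ g x) :
    HasDerivAt (fun t : ℝ => (φ t + c * ψ t) * Complex.exp (-(c * t)) / (2 * c))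
      ((g - c ^ 2 * ψ x) * Complex.exp (-(c * x)) / (2 * c)) x := by
  have he : HasDerivAt (fun t : ℝ => Complex.exp (-(c * t)))
      (Complex.exp (-(c * x)) * -(c * 1)) x :=
    ((Complex.ofRealCLM.hasDerivAt (x := x)).const_mul c).neg.cexp
  refine (((hφ.add (hψ.const_mul c)).mul he).div_const (2 * c)).congr_deriv ?_
  simp only [Pi.add_apply]
  ring

theorem jost_asymptotics_positive_energy
    (ω : ℝ) (hω : 0 < ω) (w : ℝ → ℝ) (hwm : Measurable w)
    (hwi : IntegrableOn w (Set.Ici 0))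
    (ψ : ℝ → ℂ) (hψ : ContDiffOn ℝ 2 ψ (Set.Ici 0))
    (heq : ∀ x ∈ Set.Ici (0 : ℝ),
      -(derivWithin (derivWithin ψ (Set.Ici 0)) (Set.Ici 0) x)
        - (ω ^ 2 : ℂ) * ψ x + (w x : ℂ) * ψ x = 0) :
    ∃! p : ℂ × ℂ, Tendsto (fun x : ℝ =>
        ψ x - p.1 * Complex.exp (Complex.I * ω * x)
            - p.2 * Complex.exp (-(Complex.I * ω * x)))
      atTop (nhds 0) := by
  set φ := derivWithin ψ (Set.Ici 0)
  have hφ : ContDiffOn ℝ 1 φ (Set.Ici 0) :=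
    hψ.derivWithin (uniqueDiffOn_Ici 0) (by norm_num)
  have hg : ContinuousOn (derivWithin φ (Set.Ici 0)) (Set.Ici 0) :=
    hφ.continuousOn_derivWithin (uniqueDiffOn_Ici 0) (by norm_num)
  have hψ' : ∀ x, 0 < x → HasDerivAt ψ (φ x) x := fun x hx =>
    ((hψ.differentiableOn (by norm_num)) x hx.le).hasDerivWithinAt.hasDerivAt (Ici_mem_nhds hx)
  have hφ' : ∀ x, 0 < x → HasDerivAt φ (derivWithin φ (Set.Ici 0) x) x := fun x hx =>
    ((hφ.differentiableOn (by norm_num)) x hx.le).hasDerivWithinAt.hasDerivAt (Ici_mem_nhds hx)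
  -- the source term is continuous by the equation, although the potential need not be
  have hsrc : ContinuousOn (fun x => (w x : ℂ) * ψ x) (Set.Ici 0) := by
    refine (hg.add (continuousOn_const (c := (ω ^ 2 : ℂ)).mul hψ.continuousOn)).congr
      fun x hx => ?_
    simp only [Pi.add_apply, Pi.mul_apply]
    linear_combination heq x hx
  let amp : ℂ → ℝ → ℂ := fun c t => (φ t + c * ψ t) * Complex.exp (-(c * t)) / (2 * c)
  let damp : ℂ → ℝ → ℂ := fun c t => (w t : ℂ) * ψ t * Complex.exp (-(c * t)) / (2 * c)
  have hamp : ∀ c : ℂ, c ^ 2 = -(ω : ℂ) ^ 2 → ∀ x, 0 < x →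
      HasDerivAt (amp c) (damp c x) x := by
    intro c hc x hx
    refine (hasDerivAt_amplitude (hψ' x hx) (hφ' x hx)).congr_deriv ?_
    rw [hc]
    congr 2
    linear_combination -heq x hx.le
  have hdampc : ∀ c, ContinuousOn (damp c) (Set.Ici 0) := fun c =>
    (hsrc.mul (by fun_prop)).div_const _
  obtain ⟨c, hcdef⟩ : ∃ c : ℂ, c = Complex.I * ω := ⟨_, rfl⟩
  have hc0 : c ≠ 0 := by simp [hcdef, hω.ne']
  have hcsq : c ^ 2 = -(ω : ℂ) ^ 2 := by
    rw [hcdef, mul_pow, Complex.I_sq]; ring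
  have hcsq' : (-c) ^ 2 = -(ω : ℂ) ^ 2 := by rw [neg_sq, hcsq]
  have hexp : ∀ x : ℝ, ‖Complex.exp (c * x)‖ = 1 := fun x => by
    have : c * x = ((ω * x : ℝ) : ℂ) * Complex.I := by rw [hcdef]; push_cast; ring
    rw [this, Complex.norm_exp_ofReal_mul_I]
  have hexp' : ∀ x : ℝ, ‖Complex.exp (-(c * x))‖ = 1 := fun x => by
    rw [Complex.exp_neg, norm_inv, hexp, inv_one]
  have hcn : ‖c‖ = ω := by simp [hcdef, abs_of_pos hω]
  have hdn : ∀ x, ‖damp c x‖ = |w x| * ‖ψ x‖ / (2 * ω) := fun x => by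
    simp [damp, hexp', hcn]
  have hdn' : ∀ x, ‖damp (-c) x‖ = |w x| * ‖ψ x‖ / (2 * ω) := fun x => by
    simp [damp, hexp, hcn]
  have hrep : ∀ x : ℝ, ψ x = amp c x * Complex.exp (c * x)
      + amp (-c) x * Complex.exp (-(c * x)) := by
    intro x
    have he : Complex.exp (c * x) ≠ 0 := Complex.exp_ne_zero _
    simp only [amp, neg_mul, Complex.exp_neg]
    field_simp
    ring
  have hwi0 : IntegrableOn w (Set.Ioi 0) := hwi.mono_set Set.Ioi_subset_Ici_self
  have hvi : IntegrableOn (fun t => |w t| / ω) (Set.Ioi 0) := hwi0.abs.div_const ω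
  obtain ⟨X, hX0, hX⟩ :=
    exists_intervalIntegral_le_of_integrableOn_Ioi hvi (ε := 1 / 2) (by norm_num)
  have hgrow : ∀ d : ℂ, d ^ 2 = -(ω : ℂ) ^ 2 →
      (∀ x, ‖damp d x‖ = |w x| * ‖ψ x‖ / (2 * ω)) → ∀ x, X ≤ x →
      ‖amp d x‖ ≤ ‖amp d X‖ + ∫ t in X..x, |w t| * ‖ψ t‖ / (2 * ω) := by
    intro d hd hn x hx
    have hF : ∫ t in X..x, damp d t = amp d x - amp d X := by
      refine intervalIntegral.integral_eq_sub_of_hasDerivAt (fun t ht => ?_) ?_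
      · rw [Set.uIcc_of_le hx] at ht
        exact hamp d hd t (hX0.trans_le ht.1)
      · refine ((hdampc d).mono fun t ht => ?_).intervalIntegrable
        rw [Set.uIcc_of_le hx] at ht
        exact hX0.le.trans ht.1
    have hle := intervalIntegral.norm_integral_le_integral_norm (f := damp d) (μ := volume) hx
    simp only [hn, hF] at hle
    have := norm_le_norm_add_norm_sub' (amp d x) (amp d X)
    linarith
  have hbound : ∀ x, X ≤ x → ‖ψ x‖ ≤ 2 * (‖amp c X‖ + ‖amp (-c) X‖) := by
    intro x hx
    refine norm_le_two_mul_of_le_add_intervalIntegral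
      (hψ.continuousOn.mono (Set.Ici_subset_Ici.2 hX0.le))
      (fun t => div_nonneg (abs_nonneg (w t)) hω.le)
      (hvi.mono_set (Set.Ioi_subset_Ioi hX0.le)) hX (fun y hy => ?_) hx
    have h1 := hgrow c hcsq hdn y hy
    have h2 := hgrow (-c) hcsq' hdn' y hy
    have h3 : ‖ψ y‖ ≤ ‖amp c y‖ + ‖amp (-c) y‖ := by
      conv_lhs => rw [hrep y]
      refine (norm_add_le _ _).trans_eq ?_
      rw [norm_mul, norm_mul, hexp, hexp', mul_one, mul_one]
    have h4 : ∫ t in X..y, |w t| / ω * ‖ψ t‖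
        = 2 * ∫ t in X..y, |w t| * ‖ψ t‖ / (2 * ω) := by
      rw [← intervalIntegral.integral_const_mul]
      congr 1
      ext t
      field_simp
    rw [h4]
    linarith
  have hlim : ∀ d : ℂ, d ^ 2 = -(ω : ℂ) ^ 2 →
      (∀ x, ‖damp d x‖ = |w x| * ‖ψ x‖ / (2 * ω)) →
      ∃ L, Tendsto (amp d) atTop (nhds L) := by
    intro d hd hn
    refine ⟨_, tendsto_limUnder_of_hasDerivAt_of_integrableOn_Ioi (a := X) (f' := damp d)
      (fun x hx => hamp d hd x (hX0.trans hx)) ?_⟩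
    refine Integrable.mono' (g := fun t => |w t| * (2 * (‖amp c X‖ + ‖amp (-c) X‖)) / (2 * ω))
      (((hwi0.mono_set (Set.Ioi_subset_Ioi hX0.le)).abs.mul_const _).div_const _)
      (((hdampc d).mono fun t ht => (hX0.trans ht).le).aestronglyMeasurable measurableSet_Ioi) ?_
    refine (ae_restrict_mem measurableSet_Ioi).mono fun t ht => ?_
    rw [hn]
    have := hbound t (le_of_lt ht)
    gcongr
  obtain ⟨A, hA⟩ := hlim c hcsq hdn
  obtain ⟨B, hB⟩ := hlim (-c) hcsq' hdn'
  rw [← hcdef]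
  have hAB : Tendsto (fun x : ℝ => ψ x - A * Complex.exp (c * x) - B * Complex.exp (-(c * x)))
      atTop (nhds 0) := by
    refine squeeze_zero_norm (a := fun x => ‖amp c x - A‖ + ‖amp (-c) x - B‖) (fun x => ?_) ?_
    · have : ψ x - A * Complex.exp (c * x) - B * Complex.exp (-(c * x))
          = (amp c x - A) * Complex.exp (c * x)
            + (amp (-c) x - B) * Complex.exp (-(c * x)) := by
        rw [hrep x]; ring
      rw [this]
      refine (norm_add_le _ _).trans_eq ?_
      rw [norm_mul, norm_mul, hexp, hexp', mul_one, mul_one]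
    · simpa using (hA.sub_const A).norm.add (hB.sub_const B).norm
  refine ⟨(A, B), hAB, fun p hp => ?_⟩
  have hdiff := hAB.sub hp
  rw [sub_zero] at hdiff
  have h1 : p.1 - A = 0 := by
    refine eq_zero_of_tendsto_planeWaves (D := p.2 - B) hω.ne' (hdiff.congr fun x => ?_)
    rw [← hcdef]
    ring
  have h2 : p.2 - B = 0 := by
    refine eq_zero_of_tendsto_planeWaves (D := p.1 - A) (neg_ne_zero.2 hω.ne')
      (hdiff.congr fun x => ?_)
    rw [Complex.ofReal_neg, mul_neg, ← hcdef, neg_mul, neg_neg]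
    ring
  exact Prod.ext (sub_eq_zero.1 h1) (sub_eq_zero.1 h2)
end

section
/- Let b : ℝ → ℝ be continuous, α > −1, c₁ > 0, and assume b(x)/x^α → c₁ as x → +∞. Let a(x) = a₀ + ∫₀ˣ b(u) du, and assume that a(x) has a limit φ₋ ∈ ℝ ∪ {−∞} as x → −∞. Set c₀ = c₁/(1+α). Then there exists ξ₀ ∈ ℝ such that for every ξ ≥ ξ₀ there is a unique x_ξ ∈ ℝ with a(x_ξ) = ξ, and moreover x_ξ·(c₀/ξ)^{1/(1+α)} → 1 as ξ → +∞. -/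
open MeasureTheory Filter

open Topology in
/-- One half of L'Hôpital's rule at `+∞` for a denominator tending to `+∞`. -/
theorem eventually_lt_div_of_le_deriv {f g f' g' : ℝ → ℝ} {m m' : ℝ}
    (hf : ∀ᶠ x in atTop, HasDerivAt f (f' x) x) (hg : ∀ᶠ x in atTop, HasDerivAt g (g' x) x)
    (hgtop : Tendsto g atTop atTop) (hle : ∀ᶠ x in atTop, m * g' x ≤ f' x) (hm : m' < m) :
    ∀ᶠ x in atTop, m' < f x / g x := by
  obtain ⟨X, hX⟩ := eventually_atTop.1 (hf.and (hg.and hle))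
  have hderiv : ∀ x ∈ Set.Ici X, HasDerivAt (fun x => f x - m * g x) (f' x - m * g' x) x :=
    fun x hx => (hX x hx).1.sub ((hX x hx).2.1.const_mul m)
  have hmono : MonotoneOn (fun x => f x - m * g x) (Set.Ici X) := by
    refine monotoneOn_of_deriv_nonneg (convex_Ici X)
      (fun x hx => (hderiv x hx).continuousAt.continuousWithinAt)
      (fun x hx => (hderiv x (interior_subset hx)).differentiableAt.differentiableWithinAt)
      fun x hx => ?_
    rw [(hderiv x (interior_subset hx)).deriv]
    linarith [(hX x (interior_subset hx)).2.2]
  have hlim : Tendsto (fun x => m + (f X - m * g X) / g x) atTop (𝓝 (m + 0)) :=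
    tendsto_const_nhds.add (hgtop.const_div_atTop _)
  filter_upwards [hlim.eventually_const_lt (by simpa using hm), eventually_ge_atTop X,
    hgtop.eventually_gt_atTop 0] with x hx hXx hgx
  refine hx.trans_le ?_
  rw [le_div_iff₀ hgx, add_mul, div_mul_cancel₀ _ hgx.ne']
  have h := hmono (Set.mem_Ici.2 le_rfl) hXx hXx
  simp only at h
  linarith

open Topology in
/-- L'Hôpital's rule at `+∞` for a denominator tending to `+∞`. -/
theorem tendsto_div_of_tendsto_deriv_div {f g f' g' : ℝ → ℝ} {l : ℝ}
    (hf : ∀ᶠ x in atTop, HasDerivAt f (f' x) x) (hg : ∀ᶠ x in atTop, HasDerivAt g (g' x) x)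
    (hg' : ∀ᶠ x in atTop, 0 < g' x) (hgtop : Tendsto g atTop atTop)
    (h : Tendsto (fun x => f' x / g' x) atTop (𝓝 l)) :
    Tendsto (fun x => f x / g x) atTop (𝓝 l) := by
  refine tendsto_order.2 ⟨fun m' hm' => ?_, fun m' hm' => ?_⟩
  · obtain ⟨m, hm'm, hml⟩ := exists_between hm'
    refine eventually_lt_div_of_le_deriv hf hg hgtop ?_ hm'm
    filter_upwards [h.eventually_const_lt hml, hg'] with x hx hgx
    exact ((lt_div_iff₀ hgx).1 hx).le
  · obtain ⟨m, hlm, hmm'⟩ := exists_between hm'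
    have hneg := eventually_lt_div_of_le_deriv (f := fun x => -f x) (f' := fun x => -f' x)
      (hf.mono fun x hx => hx.neg) hg hgtop (m := -m) ?_ (neg_lt_neg hmm')
    · filter_upwards [hneg] with x hx
      rw [neg_div] at hx
      exact neg_lt_neg_iff.1 hx
    · filter_upwards [h.eventually_lt_const hlm, hg'] with x hx hgx
      linarith [(div_lt_iff₀ hgx).1 hx]

/-- A continuous function with a limit different from `+∞` at `−∞` is bounded above on every
left half-line. -/
theorem bddAbove_image_Iic_of_tendsto_atBot {a : ℝ → ℝ} (ha : Continuous a) {φ : EReal}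
    (hφ : φ ≠ ⊤) (hlim : Tendsto (fun x => (a x : EReal)) atBot (nhds φ)) (Z : ℝ) :
    BddAbove (a '' Set.Iic Z) := by
  obtain ⟨M, hφM, -⟩ := EReal.lt_iff_exists_real_btwn.1 hφ.lt_top
  obtain ⟨Y, hY⟩ := eventually_atBot.1 (hlim.eventually_lt_const hφM)
  have hleft : BddAbove (a '' Set.Iic Y) := by
    refine ⟨M, ?_⟩
    rintro _ ⟨x, hx, rfl⟩
    exact (EReal.coe_lt_coe_iff.1 (hY x hx)).le
  refine (hleft.union (isCompact_Icc.image ha : IsCompact (a '' Set.Icc Y Z)).bddAbove).mono ?_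
  rw [← Set.image_union]
  refine Set.image_mono fun x hx => ?_
  exact (le_total x Y).imp id fun h => ⟨h, hx⟩

/-- If `b(x) ∼ c₁ x^α` at `+∞` with `α > −1`, `c₁ > 0`, and `a` has a limit
`φ₋ ∈ ℝ ∪ {−∞}` at `−∞`, then for `ξ` large enough the equation `a(x) = ξ` has a
unique solution `x_ξ`, and `x_ξ ∼ (ξ/c₀)^{1/(1+α)}` with `c₀ = c₁/(1+α)`. -/
theorem unique_preimage_and_asymptotics
    (b : ℝ → ℝ) (hb : Continuous b) (α : ℝ) (hα : -1 < α)
    (c₁ : ℝ) (hc₁ : 0 < c₁)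
    (hbas : Tendsto (fun x => b x / x ^ α) atTop (nhds c₁))
    (a₀ : ℝ) (a : ℝ → ℝ) (ha : ∀ x, a x = a₀ + ∫ u in (0:ℝ)..x, b u)
    (φm : EReal) (hφm : φm ≠ ⊤)
    (hlim : Tendsto (fun x => (a x : EReal)) atBot (nhds φm)) :
    ∃ ξ₀ : ℝ, (∀ ξ ≥ ξ₀, ∃! x : ℝ, a x = ξ) ∧
      ∀ xξ : ℝ → ℝ, (∀ ξ ≥ ξ₀, a (xξ ξ) = ξ) →
        Tendsto (fun ξ => xξ ξ * (c₁ / (1 + α) / ξ) ^ ((1 : ℝ) / (1 + α)))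
          atTop (nhds 1) := by
  have hα' : 0 < 1 + α := by linarith
  have hderiv : ∀ x, HasDerivAt a (b x) x := fun x => by
    rw [funext ha]
    exact (intervalIntegral.integral_hasDerivAt_right (hb.intervalIntegrable _ _)
      hb.stronglyMeasurable.stronglyMeasurableAtFilter hb.continuousAt).const_add a₀
  have hcont : Continuous a := continuous_iff_continuousAt.2 fun x => (hderiv x).continuousAt
  have hpow : Tendsto (fun x : ℝ => x ^ (1 + α)) atTop atTop := tendsto_rpow_atTop hα'
  have hratio : Tendsto (fun x => a x / x ^ (1 + α)) atTop (nhds (c₁ / (1 + α))) := by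
    refine tendsto_div_of_tendsto_deriv_div (g' := fun x => (1 + α) * x ^ α)
      (Eventually.of_forall hderiv) ?_ ?_ hpow ?_
    · filter_upwards [eventually_gt_atTop 0] with x hx
      simpa using Real.hasDerivAt_rpow_const (x := x) (p := 1 + α) (Or.inl hx.ne')
    · filter_upwards [eventually_gt_atTop 0] with x hx
      positivity
    · refine (hbas.div_const (1 + α)).congr fun x => ?_
      rw [div_div, mul_comm]
  have hc₀ : 0 < c₁ / (1 + α) := div_pos hc₁ hα'
  have htop : Tendsto a atTop atTop := by
    refine (hratio.pos_mul_atTop hc₀ hpow).congr' ?_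
    filter_upwards [eventually_gt_atTop 0] with x hx
    exact div_mul_cancel₀ _ (Real.rpow_pos_of_pos hx _).ne'
  have hbdd := bddAbove_image_Iic_of_tendsto_atBot hcont hφm hlim
  have hbpos : ∀ᶠ x in atTop, 0 < b x := by
    filter_upwards [hbas.eventually_const_lt hc₁, eventually_gt_atTop 0] with x hx hx0
    exact (div_pos_iff_of_pos_right (Real.rpow_pos_of_pos hx0 _)).1 hx
  obtain ⟨X, hX⟩ := eventually_atTop.1 hbpos
  have hmono : StrictMonoOn a (Set.Ici X) := by
    refine strictMonoOn_of_deriv_pos (convex_Ici X) hcont.continuousOn fun x hx => ?_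
    rw [(hderiv x).deriv]
    exact hX x (interior_subset hx)
  obtain ⟨K, hK⟩ := hbdd X
  have hlarge : ∀ x, K < a x → x ∈ Set.Ici X := fun x hx => by
    by_contra hlt
    exact hx.not_ge (hK ⟨x, (Set.notMem_Ici.1 hlt).le, rfl⟩)
  refine ⟨K + 1, fun ξ hξ => ?_, fun xξ hxξ => ?_⟩
  · have haX : a X ≤ ξ := by linarith [hK ⟨X, Set.mem_Iic.2 le_rfl, rfl⟩]
    obtain ⟨Y, hY⟩ := (htop.eventually_ge_atTop ξ).exists
    obtain ⟨x, rfl⟩ := mem_range_of_exists_le_of_exists_ge hcont ⟨X, haX⟩ ⟨Y, hY⟩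
    refine ⟨x, rfl, fun y hy => ?_⟩
    have hy' : a y = a x := hy
    exact hmono.injOn (hlarge y (by linarith)) (hlarge x (by linarith)) hy'
  · have hxtop : Tendsto xξ atTop atTop := by
      refine tendsto_atTop.2 fun Z => ?_
      obtain ⟨M, hM⟩ := hbdd Z
      filter_upwards [eventually_ge_atTop (K + 1), eventually_gt_atTop M] with ξ hξ hMξ
      by_contra hlt
      have := hM ⟨xξ ξ, (not_le.1 hlt).le, rfl⟩
      linarith [hxξ ξ hξ]
    have hquot : Tendsto (fun x => (c₁ / (1 + α) / (a x / x ^ (1 + α))) ^ ((1 : ℝ) / (1 + α)))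
        atTop (nhds 1) := by
      have h := ((tendsto_const_nhds (x := c₁ / (1 + α))).div hratio hc₀.ne').rpow_const
        (p := (1 : ℝ) / (1 + α)) (Or.inr (by positivity))
      simpa only [Pi.div_apply, div_self hc₀.ne', Real.one_rpow] using h
    refine (hquot.comp hxtop).congr' ?_
    filter_upwards [eventually_ge_atTop (K + 1), eventually_gt_atTop 0,
      hxtop.eventually_gt_atTop 0] with ξ hξ hξ0 hx0
    rw [Function.comp_apply, hxξ ξ hξ, ← div_mul, mul_comm,
      Real.mul_rpow (by positivity) (by positivity), ← Real.rpow_mul hx0.le,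
      mul_one_div_cancel hα'.ne', Real.rpow_one]
end

section
/- Let b : ℝ → ℝ be continuously differentiable, α ∈ (−1,0) ∪ (0,∞), c₁, C > 0 with b(x)/x^α → c₁ as x → +∞ and |b'(x)| ≤ C(1+x²)^{(α−1)/2} for all x. Let a(x) = a₀ + ∫₀ˣ b(u) du and assume a has a limit φ₋ ∈ ℝ ∪ {−∞} as x → −∞. For ξ large, let x_ξ denote the unique solution of a(x_ξ) = ξ. Then for every ε ∈ (0,1/2) there exist c_∞ > 0 and ξ₀ ∈ ℝ such that for all ξ ≥ ξ₀ and all s ∈ ℝ with |s| ≥ ε: (1 − ξ^{−1}·a(x_ξ·(1+s)))² ≥ c_∞. -/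
open MeasureTheory Filter

/-- A continuous function whose limit at `-∞` is not `+∞` is bounded above on every left half-line. -/
theorem exists_forall_le_of_tendsto_atBot_ne_top {a : ℝ → ℝ} (ha : Continuous a) {φ : EReal}
    (hφ : φ ≠ ⊤) (hlim : Tendsto (fun x => (a x : EReal)) atBot (nhds φ)) (X : ℝ) :
    ∃ M, ∀ x ≤ X, a x ≤ M := by
  obtain ⟨m, hm, -⟩ := EReal.lt_iff_exists_real_btwn.1 (lt_top_iff_ne_top.2 hφ)
  obtain ⟨Y, hY⟩ := eventually_atBot.1 (hlim.eventually_lt_const hm)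
  obtain ⟨N, hN⟩ := (isCompact_Icc (a := Y) (b := X)).bddAbove_image ha.continuousOn
  refine ⟨max m N, fun x hx => ?_⟩
  rcases le_total x Y with h | h
  · exact le_max_of_le_left (EReal.coe_lt_coe_iff.1 (hY x h)).le
  · exact le_max_of_le_right (hN ⟨x, ⟨h, hx⟩, rfl⟩)

/-- If `f' ≤ g'` pointwise on `[X, ∞)`, increments of `f` are at most those of `g`. -/
theorem sub_le_sub_of_hasDerivAt_le {f g f' g' : ℝ → ℝ} {X : ℝ}
    (hf : ∀ x ≥ X, HasDerivAt f (f' x) x) (hg : ∀ x ≥ X, HasDerivAt g (g' x) x)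
    (h : ∀ x ≥ X, f' x ≤ g' x) {x y : ℝ} (hx : X ≤ x) (hxy : x ≤ y) :
    f y - f x ≤ g y - g x := by
  have hmono : MonotoneOn (fun x => g x - f x) (Set.Ici X) := by
    refine monotoneOn_of_deriv_nonneg (convex_Ici X)
      (fun z hz => ((hg z hz).sub (hf z hz)).continuousAt.continuousWithinAt)
      (fun z hz => ?_) (fun z hz => ?_) <;> rw [interior_Ici] at hz
    · exact ((hg z hz.le).sub (hf z hz.le)).differentiableAt.differentiableWithinAt
    · have := ((hg z hz.le).sub (hf z hz.le)).deriv
      change 0 ≤ deriv (g - f) z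
      rw [this]
      exact sub_nonneg.2 (h z hz.le)
  have := hmono (Set.mem_Ici.2 hx) (Set.mem_Ici.2 (hx.trans hxy)) hxy
  simp only at this
  linarith

/-- If `a' x / x ^ α` has a positive limit at `+∞` with `α > -1`, the increments of `a` are
eventually comparable to those of `x ^ (α + 1)`. -/
theorem exists_increments_comparable_rpow {a b : ℝ → ℝ} (ha : ∀ x, HasDerivAt a (b x) x)
    {α c : ℝ} (hα : -1 < α) (hc : 0 < c)
    (hb : Tendsto (fun x => b x / x ^ α) atTop (nhds c)) :
    ∃ k > 0, ∃ K > 0, ∃ X > 0, ∀ x y, X ≤ x → x ≤ y →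
      k * (y ^ (α + 1) - x ^ (α + 1)) ≤ a y - a x ∧
      a y - a x ≤ K * (y ^ (α + 1) - x ^ (α + 1)) := by
  have hβ : 0 < α + 1 := by linarith
  obtain ⟨X, hX⟩ := eventually_atTop.1 ((hb.eventually_const_lt (half_lt_self hc)).and
    ((hb.eventually_lt_const (show c < 2 * c by linarith)).and (eventually_gt_atTop 0)))
  have hpow : ∀ k x, X ≤ x →
      HasDerivAt (fun x => k / (α + 1) * x ^ (α + 1)) (k * x ^ α) x := by
    intro k x hx
    have h := (Real.hasDerivAt_rpow_const (p := α + 1)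
      (Or.inl (hX x hx).2.2.ne')).const_mul (k / (α + 1))
    rwa [add_sub_cancel_right, ← mul_assoc, div_mul_cancel₀ k hβ.ne'] at h
  refine ⟨c / 2 / (α + 1), by positivity, 2 * c / (α + 1), by positivity, X,
    (hX X le_rfl).2.2, fun x y hx hxy => ⟨?_, ?_⟩⟩
  · rw [mul_sub]
    refine sub_le_sub_of_hasDerivAt_le (hpow (c / 2)) (fun x _ => ha x) (fun z hz => ?_) hx hxy
    exact ((lt_div_iff₀ (Real.rpow_pos_of_pos (hX z hz).2.2 α)).1 (hX z hz).1).le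
  · rw [mul_sub]
    refine sub_le_sub_of_hasDerivAt_le (fun x _ => ha x) (hpow (2 * c)) (fun z hz => ?_) hx hxy
    exact ((div_lt_iff₀ (Real.rpow_pos_of_pos (hX z hz).2.2 α)).1 (hX z hz).2.1).le

/-- Coercivity of the rescaled fiber potential away from its minimum: under the
assumptions of the semi-confined theorem, for every `ε ∈ (0,1/2)` there is `c∞ > 0`
such that for `ξ` large and `|s| ≥ ε` one has `(1 − ξ⁻¹ a(x_ξ(1+s)))² ≥ c∞`, where
`x_ξ` is the unique solution of `a(x_ξ) = ξ`. -/
theorem rescaled_potential_coercive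
    (b : ℝ → ℝ) (hb : ContDiff ℝ 1 b) (α : ℝ)
    (hα : α ∈ Set.Ioo (-1 : ℝ) 0 ∪ Set.Ioi (0 : ℝ))
    (c₁ C : ℝ) (hc₁ : 0 < c₁) (hC : 0 < C)
    (hbas : Tendsto (fun x => b x / x ^ α) atTop (nhds c₁))
    (hb' : ∀ x : ℝ, |deriv b x| ≤ C * (1 + x ^ 2) ^ ((α - 1) / 2))
    (a₀ : ℝ) (a : ℝ → ℝ) (ha : ∀ x, a x = a₀ + ∫ u in (0:ℝ)..x, b u)
    (φm : EReal) (hφm : φm ≠ ⊤)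
    (hlim : Tendsto (fun x => (a x : EReal)) atBot (nhds φm)) :
    ∃ ξ₁ : ℝ, (∀ ξ ≥ ξ₁, ∃! x : ℝ, a x = ξ) ∧
      ∀ ε : ℝ, 0 < ε → ε < 1 / 2 →
        ∃ cinf > 0, ∃ ξ₀ ≥ ξ₁, ∀ ξ ≥ ξ₀, ∀ xξ : ℝ, a xξ = ξ →
          ∀ s : ℝ, ε ≤ |s| → cinf ≤ (1 - ξ⁻¹ * a (xξ * (1 + s))) ^ 2 := by
  have hα1 : -1 < α := by
    rcases hα with h | h
    · exact h.1
    · exact neg_one_lt_zero.trans h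
  have hder : ∀ x, HasDerivAt a (b x) x := fun x => by
    rw [funext ha]
    exact (intervalIntegral.integral_hasDerivAt_right (hb.continuous.intervalIntegrable _ _)
      (hb.continuous.stronglyMeasurableAtFilter _ _) hb.continuous.continuousAt).const_add a₀
  have hcont : Continuous a := continuous_iff_continuousAt.2 fun x => (hder x).continuousAt
  have hbdd := exists_forall_le_of_tendsto_atBot_ne_top hcont hφm hlim
  obtain ⟨k, hk, K, hK, X, hX, hinc⟩ := exists_increments_comparable_rpow hder hα1 hc₁ hbas
  have hβ : 0 < α + 1 := by linarith
  set β := α + 1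
  have hstrict : StrictMonoOn a (Set.Ici X) := fun x hx y _ hxy => by
    have h := (hinc x y hx hxy.le).1
    have := mul_pos hk (sub_pos.2 (Real.rpow_lt_rpow (hX.le.trans hx) hxy hβ))
    linarith
  have hpow := tendsto_rpow_atTop hβ
  have htop : Tendsto a atTop atTop := by
    have h : Tendsto (fun x => a X - k * X ^ β + k * x ^ β) atTop atTop :=
      tendsto_atTop_add_const_left _ _ (hpow.const_mul_atTop hk)
    refine tendsto_atTop_mono' _ ?_ h
    filter_upwards [eventually_ge_atTop X] with x hx
    have := (hinc X x le_rfl hx).1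
    linarith
  obtain ⟨M, hM⟩ := hbdd X
  refine ⟨M + 1, fun ξ hξ => ?_, fun ε hε hε2 => ?_⟩
  · obtain ⟨Y, hY, hXY⟩ := ((htop.eventually_ge_atTop ξ).and (eventually_ge_atTop X)).exists
    obtain ⟨x, -, hx⟩ := intermediate_value_Icc hXY hcont.continuousOn
      (show ξ ∈ Set.Icc (a X) (a Y) from ⟨by linarith [hM X le_rfl], hY⟩)
    have hgt : ∀ y, a y = ξ → X ≤ y := fun y hy => by
      by_contra! h
      linarith [hM y h.le]
    exact ⟨x, hx, fun y hy => hstrict.injOn (hgt y hy) (hgt x hx) (hy.trans hx.symm)⟩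
  · obtain ⟨Z, hZ⟩ := eventually_atTop.1 (hpow.eventually_ge_atTop (a X / K))
    obtain ⟨N, hN⟩ := hbdd (max Z (2 * X))
    have hp : 0 < (1 + ε) ^ β - 1 := sub_pos.2 (Real.one_lt_rpow (by linarith) hβ)
    have hq : 0 < 1 - (1 - ε) ^ β :=
      sub_pos.2 (Real.rpow_lt_one (by linarith) (by linarith) hβ)
    set p := (1 + ε) ^ β - 1 with hp_def
    set q := 1 - (1 - ε) ^ β with hq_def
    obtain ⟨δ, hδ, hδp, hδq, hδ2⟩ : ∃ δ > 0, δ ≤ k / (2 * K) * p ∧ δ ≤ k / (2 * K) * q ∧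
        δ ≤ 1 / 2 :=
      ⟨min (k / (2 * K) * p) (min (k / (2 * K) * q) (1 / 2)), by positivity, min_le_left _ _,
        (min_le_right _ _).trans (min_le_left _ _), (min_le_right _ _).trans (min_le_right _ _)⟩
    refine ⟨δ ^ 2, by positivity, max (M + 1) (max (N + 1) (max 1 (2 * M))), le_max_left _ _,
      fun ξ hξ x hx s hs => ?_⟩
    simp only [ge_iff_le, max_le_iff] at hξ
    obtain ⟨-, hξN, hξ1, hξM⟩ := hξ
    have hξ0 : 0 < ξ := by linarith
    have hxgt : max Z (2 * X) < x := by
      by_contra! h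
      linarith [hN x h]
    obtain ⟨hxZ, hxX⟩ := max_lt_iff.1 hxgt
    have hx0 : 0 < x := by linarith
    have hξle : ξ ≤ 2 * K * x ^ β := by
      have h1 := (hinc X x le_rfl (by linarith)).2
      have h2 := (div_le_iff₀ hK).1 (hZ x hxZ.le)
      have h3 : 0 ≤ K * X ^ β := by positivity
      linarith
    have hscale : ∀ r, 0 < r → δ ≤ k / (2 * K) * r → δ * ξ ≤ k * (x ^ β * r) := fun r hr h =>
      calc δ * ξ ≤ k / (2 * K) * r * (2 * K * x ^ β) := by gcongr
        _ = k * (x ^ β * r) := by field_simp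
    have hfar : δ * ξ ≤ |ξ - a (x * (1 + s))| := by
      rcases le_abs.1 hs with h | h
      · have h1 := (hinc x (x * (1 + ε)) (by linarith) (by nlinarith)).1
        rw [Real.mul_rpow hx0.le (by linarith)] at h1
        have h2 : a (x * (1 + ε)) ≤ a (x * (1 + s)) :=
          hstrict.monotoneOn (Set.mem_Ici.2 (by nlinarith)) (Set.mem_Ici.2 (by nlinarith))
            (by gcongr)
        have h3 := hscale p hp hδp
        have h4 : x ^ β * p = x ^ β * (1 + ε) ^ β - x ^ β := by rw [hp_def]; ring
        rw [h4] at h3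
        exact le_abs.2 (Or.inr (by linarith))
      · have hlo : X ≤ x * (1 - ε) := by nlinarith
        refine le_abs.2 (Or.inl ?_)
        rcases le_total (x * (1 + s)) X with hy | hy
        · have := hM _ hy
          nlinarith
        · have h1 := (hinc (x * (1 - ε)) x hlo (by nlinarith)).1
          rw [Real.mul_rpow hx0.le (by linarith)] at h1
          have h2 : a (x * (1 + s)) ≤ a (x * (1 - ε)) :=
            hstrict.monotoneOn hy hlo (mul_le_mul_of_nonneg_left (by linarith) hx0.le)
          have h3 := hscale q hq hδq
          have h4 : x ^ β * q = x ^ β - x ^ β * (1 - ε) ^ β := by rw [hq_def]; ring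
          rw [h4] at h3
          linarith
    have hrw : 1 - ξ⁻¹ * a (x * (1 + s)) = (ξ - a (x * (1 + s))) / ξ := by field_simp
    rw [hrw, ← sq_abs (_ / ξ), abs_div, abs_of_pos hξ0]
    exact pow_le_pow_left₀ hδ.le ((le_div_iff₀ hξ0).2 hfar) 2
end
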